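/- Suppose W is finite with longest element w_S, let s, t ∈ S with s ≠ t̄ (where ū = w_S·u·w_S), let (u_i) be the rotation sequence associated to (S,s,t), d = d(S,s,t), and K = S∖{s, t̄}. Then: (i) E_d is a reduced atomic expression of width d+1 from K to S∖{t, s̄} with final element x_{d+1} = w_S; (ii) the data with L_0 = K and letters (s_1,…,s_{d+1}) = (ū_{d+1}, ū_d, …, ū_1) is a well-defined reduced atomic expression of width d+1 from K to S∖{t, s̄}, also with final element w_S. In particular both data express the same core coset W_K·w_S·W_{S∖{t,s̄}} (this is the atomic braid relation associated to (S,s,t)). -/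

import Mathlib

namespace CoxeterAtoms

variable {B : Type*} {W : Type*} [Group W] {M : CoxeterMatrix B}

/-- The standard parabolic subgroup `W_K` generated by the simple reflections indexed by `K`. -/
def par (cs : CoxeterSystem M W) (K : Set B) : Subgroup W :=
  Subgroup.closure (cs.simple '' K)

/-- `K` is finitary if `W_K` is finite. -/
def Finitary (cs : CoxeterSystem M W) (K : Set B) : Prop :=
  ((par cs K : Set W)).Finite

/-- The left coset `W_I · x`. -/
def lcos (cs : CoxeterSystem M W) (I : Set B) (x : W) : Set W :=
  {w | ∃ a ∈ par cs I, w = a * x}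

/-- The right coset `x · W_J`. -/
def rcos (cs : CoxeterSystem M W) (x : W) (J : Set B) : Set W :=
  {w | ∃ b ∈ par cs J, w = x * b}

/-- The double coset `W_I · x · W_J`. -/
def dcos (cs : CoxeterSystem M W) (I : Set B) (x : W) (J : Set B) : Set W :=
  {w | ∃ a ∈ par cs I, ∃ b ∈ par cs J, w = a * x * b}

/-- `x` is a minimal length element of its double coset `W_I · x · W_J`. -/
def IsMinRep (cs : CoxeterSystem M W) (I : Set B) (x : W) (J : Set B) : Prop :=
  ∀ w ∈ dcos cs I x J, cs.length x ≤ cs.length w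

/-- `y` is a maximal length element of the set `p`. -/
def IsMaxOf (cs : CoxeterSystem M W) (p : Set W) (y : W) : Prop :=
  y ∈ p ∧ ∀ w ∈ p, cs.length w ≤ cs.length y

/-- `y` is the longest element of the standard parabolic subgroup `W_K`. -/
def IsLongest (cs : CoxeterSystem M W) (K : Set B) (y : W) : Prop :=
  y ∈ par cs K ∧ ∀ w ∈ par cs K, cs.length w ≤ cs.length y

/-- The double coset `W_I · x · W_J` is core: `W_I·x = W_I·x·W_J = x·W_J`. -/
def IsCore (cs : CoxeterSystem M W) (I : Set B) (x : W) (J : Set B) : Prop :=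
  lcos cs I x = dcos cs I x J ∧ dcos cs I x J = rcos cs x J

/-- A reduced atomic expression `(L_0,…,L_m; s_1,…,s_m)` of width `m` from `I` to `J`,
together with the associated data: the removed letters `t_i`, the longest elements
`w_{L_i}` and `w_{K_i}` (where `K_i = L_{i-1} ∪ {s_i}`), and the partial products `x_i`. -/
structure RAtomExpr (cs : CoxeterSystem M W) (I J : Set B) (m : ℕ) where
  Lset : ℕ → Set B
  letter : ℕ → B
  tletter : ℕ → B
  wL : ℕ → W
  wK : ℕ → W
  x : ℕ → W
  hL0 : Lset 0 = I
  hLm : Lset m = J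
  hwL : ∀ i ≤ m, IsLongest cs (Lset i) (wL i)
  hmem : ∀ i, 1 ≤ i → i ≤ m → letter i ∉ Lset (i - 1)
  hfinK : ∀ i, 1 ≤ i → i ≤ m → Finitary cs (Lset (i - 1) ∪ {letter i})
  hwK : ∀ i, 1 ≤ i → i ≤ m → IsLongest cs (Lset (i - 1) ∪ {letter i}) (wK i)
  ht : ∀ i, 1 ≤ i → i ≤ m →
    cs.simple (tletter i) = wK i * cs.simple (letter i) * wK i
  hLi : ∀ i, 1 ≤ i → i ≤ m → Lset i = (Lset (i - 1) ∪ {letter i}) \ {tletter i}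
  hx0 : x 0 = wL 0
  hx : ∀ i, 1 ≤ i → i ≤ m → x i = x (i - 1) * wL (i - 1) * wK i
  hred : ∀ i, 1 ≤ i → i ≤ m →
    (cs.length (x i) : ℤ) =
      (cs.length (x (i - 1)) : ℤ) - cs.length (wL (i - 1)) + cs.length (wK i)

/-! ### Injectivity of the simple reflections, via the geometric representation -/

section Geometric

open Polynomial.Chebyshev

/-- The linear form `2⟨e_i, ·⟩` of the geometric representation. -/
noncomputable def geoForm (M : CoxeterMatrix B) (i : B) : Module.Dual ℝ (B →₀ ℝ) :=
  Finsupp.lsum ℝ (fun j => (-2 * Real.cos (Real.pi / M i j)) • LinearMap.id)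

theorem geoForm_single (M : CoxeterMatrix B) (i j : B) :
    geoForm M i (Finsupp.single j 1) = -2 * Real.cos (Real.pi / M i j) := by
  simp [geoForm]

theorem geoForm_self (M : CoxeterMatrix B) (i : B) :
    geoForm M i (Finsupp.single i 1) = 2 := by
  simp [geoForm_single]

/-- The simple reflections of the geometric representation. -/
noncomputable def geoRefl (M : CoxeterMatrix B) (i : B) : (B →₀ ℝ) ≃ₗ[ℝ] (B →₀ ℝ) :=
  Module.reflection (geoForm_self M i)

theorem S_vanish_even (p : ℕ) (hp : 2 ≤ p) :
    (S ℝ ((p : ℤ) - 1)).eval (2 * Real.cos (Real.pi / p)) = 0 := by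
  have h := S_two_mul_real_cos (Real.pi / p) ((p : ℤ) - 1)
  have hp' : (2 : ℝ) ≤ p := by exact_mod_cast hp
  have h0 : 0 < Real.sin (Real.pi / p) := by
    apply Real.sin_pos_of_pos_of_lt_pi
    · positivity
    · apply div_lt_self Real.pi_pos; linarith
  have h2 : Real.sin (((((p : ℤ) - 1 : ℤ) : ℝ) + 1) * (Real.pi / p)) = 0 := by
    have : ((((p : ℤ) - 1 : ℤ) : ℝ) + 1) * (Real.pi / p) = Real.pi := by
      push_cast; field_simp; ring
    rw [this, Real.sin_pi]
  rw [h2] at h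
  exact (mul_eq_zero.mp h).resolve_right h0.ne'

theorem S_vanish_odd (p : ℕ) (hp : 1 ≤ p) :
    (S ℝ (p : ℤ)).eval (2 * Real.cos (2 * Real.pi / (2 * p + 1 : ℝ))) +
      (S ℝ ((p : ℤ) - 1)).eval (2 * Real.cos (2 * Real.pi / (2 * p + 1 : ℝ))) = 0 := by
  set θ := 2 * Real.pi / (2 * p + 1 : ℝ) with hθ
  have h := S_two_mul_real_cos θ (p : ℤ)
  have h' := S_two_mul_real_cos θ ((p : ℤ) - 1)
  have hp' : (1 : ℝ) ≤ p := by exact_mod_cast hp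
  have hpi := Real.pi_pos
  have h0 : 0 < Real.sin θ := by
    apply Real.sin_pos_of_pos_of_lt_pi
    · positivity
    · rw [hθ, div_lt_iff₀ (by positivity)]; nlinarith
  have h2 : ((((p : ℤ) : ℝ)) + 1) * θ = 2 * Real.pi - (((((p : ℤ) - 1 : ℤ) : ℝ)) + 1) * θ := by
    rw [hθ]; push_cast; field_simp; ring
  rw [h2, Real.sin_two_pi_sub] at h
  have : ((S ℝ (p : ℤ)).eval (2 * Real.cos θ) + (S ℝ ((p : ℤ) - 1)).eval (2 * Real.cos θ))
      * Real.sin θ = 0 := by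
    rw [add_mul, h, h']; ring
  exact (mul_eq_zero.mp this).resolve_right h0.ne'

theorem geoRefl_liftable (M : CoxeterMatrix B) : M.IsLiftable (geoRefl M) := by
  intro i j
  apply LinearEquiv.ext
  intro z
  have hij : geoForm M i (Finsupp.single j 1) = -2 * Real.cos (Real.pi / M i j) :=
    geoForm_single M i j
  have hji : geoForm M j (Finsupp.single i 1) = -2 * Real.cos (Real.pi / M i j) := by
    rw [geoForm_single, M.symmetric j i]
  have key := Module.reflection_mul_reflection_pow_apply (geoForm_self M i) (geoForm_self M j)
    (M i j) z (2 * Real.cos (2 * (Real.pi / M i j)))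
    (by rw [hij, hji, Real.cos_two_mul]; ring)
  change ((Module.reflection (geoForm_self M i) * Module.reflection (geoForm_self M j)) ^ (M i j)) z
    = z
  by_cases h1 : M i j = 1
  · have hh : i = j := by
      by_contra hne
      exact M.off_diagonal i j hne h1
    subst hh
    rw [h1, pow_one, LinearEquiv.mul_apply]
    exact Module.involutive_reflection (geoForm_self M i) z
  rw [key]
  rw [hij, hji]
  clear key hij hji
  generalize M i j = m at *
  obtain ⟨p, rfl | rfl⟩ := Nat.even_or_odd' m
  · have e1 : (((2 * p : ℕ) : ℤ) - 2) / 2 = (p : ℤ) - 1 := by omega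
    have e2 : (((2 * p : ℕ) : ℤ) - 1) / 2 = (p : ℤ) - 1 := by omega
    have e3 : (((2 * p : ℕ) : ℤ) - 3) / 2 = (p : ℤ) - 2 := by omega
    have e4 : (((2 * p : ℕ) : ℤ)) / 2 = (p : ℤ) := by omega
    rw [e1, e2, e3, e4]
    by_cases hp : 2 ≤ p
    · have : 2 * (Real.pi / ((2 * p : ℕ) : ℝ)) = Real.pi / p := by
        have : (p : ℝ) ≠ 0 := by positivity
        push_cast; field_simp
      rw [this, S_vanish_even p hp]
      simp
    · obtain rfl | rfl : p = 0 ∨ p = 1 := by omega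
      · simp
      · simp [S_one]
        rw [show 2 * (Real.pi / 2) = Real.pi by ring, Real.cos_pi]
        module
  · have hp : 1 ≤ p := by omega
    have e1 : (((2 * p + 1 : ℕ) : ℤ) - 2) / 2 = (p : ℤ) - 1 := by omega
    have e2 : (((2 * p + 1 : ℕ) : ℤ) - 1) / 2 = (p : ℤ) := by omega
    have e3 : (((2 * p + 1 : ℕ) : ℤ) - 3) / 2 = (p : ℤ) - 1 := by omega
    have e4 : (((2 * p + 1 : ℕ) : ℤ)) / 2 = (p : ℤ) := by omega
    rw [e1, e2, e3, e4]
    have : 2 * (Real.pi / ((2 * p + 1 : ℕ) : ℝ)) = 2 * Real.pi / (2 * p + 1 : ℝ) := by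
      push_cast; ring
    rw [this, S_vanish_odd p hp]
    simp

theorem simple_inj (cs : CoxeterSystem M W) : Function.Injective cs.simple := by
  intro i j hij
  have h := congrArg (cs.lift ⟨geoRefl M, geoRefl_liftable M⟩) hij
  rw [cs.lift_apply_simple, cs.lift_apply_simple] at h
  have h2 := LinearEquiv.congr_fun h (Finsupp.single i 1)
  by_contra hne
  have h3 := DFunLike.congr_fun h2 i
  simp only [geoRefl, Module.reflection_apply, geoForm_self] at h3
  simp [Ne.symm hne] at h3

end Geometric

/-! ### The exchange condition -/

section Exchange

open Classical in
/-- The action of a simple reflection on `W × {±1}`. -/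
noncomputable def sgnAct (cs : CoxeterSystem M W) (i : B) : Function.End (W × ZMod 2) :=
  fun p => (cs.simple i * p.1 * cs.simple i, p.2 + if p.1 = cs.simple i then 1 else 0)

theorem simple_mul_pow (cs : CoxeterSystem M W) (i j : B) (n : ℕ) :
    cs.simple j * (cs.simple i * cs.simple j) ^ n =
      ((cs.simple i * cs.simple j) ^ n)⁻¹ * cs.simple j := by
  induction n with
  | zero => simp
  | succ n ih =>
    rw [pow_succ, ← mul_assoc, ih, ← pow_succ, pow_succ', mul_inv_rev, mul_inv_rev]
    simp [mul_assoc]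

open Classical in
theorem sgnAct_pow (cs : CoxeterSystem M W) (i j : B) (n : ℕ) (w : W) (e : ZMod 2) :
    ((sgnAct cs i * sgnAct cs j) ^ n) (w, e) =
      ((cs.simple i * cs.simple j) ^ n * w * ((cs.simple i * cs.simple j) ^ n)⁻¹,
        e + ∑ k ∈ Finset.range (2 * n),
          if (cs.simple i * cs.simple j) ^ k * w = cs.simple j then 1 else 0) := by
  induction n with
  | zero =>
    simp only [pow_zero, mul_zero, Finset.range_zero, Finset.sum_empty, add_zero, one_mul, inv_one,
      mul_one]
    rfl
  | succ n ih =>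
    rw [pow_succ']
    change sgnAct cs i (sgnAct cs j (((sgnAct cs i * sgnAct cs j) ^ n) (w, e))) = _
    rw [ih]
    set r := cs.simple i * cs.simple j with hr
    have hrinv : cs.simple j * cs.simple i = r⁻¹ := by simp [hr]
    have hsr : cs.simple j * r ^ n = (r ^ n)⁻¹ * cs.simple j := simple_mul_pow cs i j n
    have c1 : (r ^ n * w * (r ^ n)⁻¹ = cs.simple j) ↔ r ^ (2 * n) * w = cs.simple j := by
      rw [mul_inv_eq_iff_eq_mul, hsr, eq_inv_mul_iff_mul_eq, ← mul_assoc, ← pow_add, two_mul]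
    have c2 : (cs.simple j * (r ^ n * w * (r ^ n)⁻¹) * cs.simple j = cs.simple i) ↔
        r ^ (2 * n + 1) * w = cs.simple j := by
      have a1 : ∀ y : W, (cs.simple j * y * cs.simple j = cs.simple i) ↔ r * y = cs.simple j := by
        intro y
        constructor
        · intro h
          have h2 : y = cs.simple j * cs.simple i * cs.simple j := by
            rw [← h]; simp [mul_assoc]
          rw [hr, h2]; simp [mul_assoc]
        · intro h
          have h' : y = r⁻¹ * cs.simple j := eq_inv_mul_of_mul_eq h
          rw [h', ← hrinv]; simp [mul_assoc]
      rw [a1, ← mul_assoc, ← mul_assoc, ← pow_succ', mul_inv_eq_iff_eq_mul, hsr,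
        eq_inv_mul_iff_mul_eq, ← mul_assoc, ← pow_add, show n + (n + 1) = 2 * n + 1 by ring]
    unfold sgnAct
    rw [show 2 * (n + 1) = 2 * n + 1 + 1 by ring, Finset.sum_range_succ, Finset.sum_range_succ]
    simp only [c1, c2]
    refine Prod.ext ?_ ?_
    · simp [pow_succ', hr, mul_assoc]
    · simp only; ring

theorem sgnAct_liftable (cs : CoxeterSystem M W) : M.IsLiftable (sgnAct cs) := by
  classical
  intro i j
  funext p
  obtain ⟨w, e⟩ := p
  rw [sgnAct_pow, two_mul, Finset.sum_range_add]
  simp only [pow_add, cs.simple_mul_simple_pow, one_mul, inv_one, mul_one, CharTwo.add_self_eq_zero,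
    add_zero]
  rfl

open Classical in
theorem sgnAct_word (cs : CoxeterSystem M W) (ω : List B) (w : W) (e : ZMod 2) :
    cs.lift ⟨sgnAct cs, sgnAct_liftable cs⟩ (cs.wordProd ω) (w, e) =
      (cs.wordProd ω * w * (cs.wordProd ω)⁻¹, e + ((cs.rightInvSeq ω).count w : ZMod 2)) := by
  induction ω with
  | nil => simp; rfl
  | cons i ω ih =>
    rw [cs.wordProd_cons, map_mul, cs.lift_apply_simple]
    change sgnAct cs i (cs.lift ⟨sgnAct cs, sgnAct_liftable cs⟩ (cs.wordProd ω) (w, e)) = _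
    rw [ih]
    simp only [sgnAct, CoxeterSystem.rightInvSeq, List.count_cons]
    refine Prod.ext ?_ ?_
    · simp [mul_assoc]
    · have : (cs.wordProd ω * w * (cs.wordProd ω)⁻¹ = cs.simple i) ↔
          ((cs.wordProd ω)⁻¹ * cs.simple i * cs.wordProd ω = w) := by
        constructor
        · intro h; rw [← h]; simp [mul_assoc]
        · intro h; rw [← h]; simp [mul_assoc]
      simp [this, add_assoc]

/-- The exchange condition. -/
theorem exchange (cs : CoxeterSystem M W) (ω : List B) (i : B)
    (h : cs.length (cs.wordProd ω * cs.simple i) < cs.length (cs.wordProd ω)) :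
    ∃ j < ω.length, cs.wordProd ω * cs.simple i = cs.wordProd (ω.eraseIdx j) := by
  classical
  obtain ⟨ω', hω', he⟩ := cs.exists_isReduced (cs.wordProd ω * cs.simple i)
  have hw : cs.wordProd (ω'.concat i) = cs.wordProd ω := by
    rw [cs.wordProd_concat, ← he]; simp
  have hred : cs.IsReduced (ω'.concat i) := by
    have h1 := cs.length_wordProd_le (ω'.concat i)
    have h2 := hω'.eq
    unfold CoxeterSystem.IsReduced
    rw [hw] at h1 ⊢
    rw [← he] at h2
    simp only [List.length_concat] at h1 ⊢
    omega
  have hc : (cs.rightInvSeq (ω'.concat i)).count (cs.simple i) = 1 := by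
    apply List.count_eq_one_of_mem hred.nodup_rightInvSeq
    rw [cs.rightInvSeq_concat]; simp
  have h1 := sgnAct_word cs (ω'.concat i) (cs.simple i) 0
  have h2 := sgnAct_word cs ω (cs.simple i) 0
  rw [hw, h2] at h1
  have h3 := congrArg Prod.snd h1
  simp only [hc, zero_add] at h3
  have hmem : cs.simple i ∈ cs.rightInvSeq ω := by
    by_contra hn
    rw [List.count_eq_zero_of_not_mem hn] at h3
    simp at h3
  obtain ⟨j, hj, hje⟩ := List.getElem_of_mem hmem
  refine ⟨j, by simpa using hj, ?_⟩
  rw [← cs.wordProd_mul_getD_rightInvSeq, List.getD_eq_getElem _ _ hj, hje]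

end Exchange

/-! ### Parabolic subgroups -/

section Parabolic

theorem simple_mem_par (cs : CoxeterSystem M W) {K : Set B} {c : B} (hc : c ∈ K) :
    cs.simple c ∈ par cs K :=
  Subgroup.subset_closure ⟨c, hc, rfl⟩

theorem wordProd_mem_par (cs : CoxeterSystem M W) {K : Set B} {ω : List B}
    (h : ∀ c ∈ ω, c ∈ K) : cs.wordProd ω ∈ par cs K := by
  induction ω with
  | nil => simp [one_mem]
  | cons i ω ih =>
    rw [cs.wordProd_cons]
    exact (par cs K).mul_mem (simple_mem_par cs (h i (by simp)))
      (ih fun c hc => h c (by simp [hc]))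

/-- Multiplication by a simple reflection, on reduced words in `K`. -/
theorem par_word_mul (cs : CoxeterSystem M W) {K : Set B} {ω : List B} {c : B}
    (hω : ∀ c ∈ ω, c ∈ K) (hr : cs.IsReduced ω) (hc : c ∈ K) :
    ∃ ω' : List B, (∀ c ∈ ω', c ∈ K) ∧ cs.IsReduced ω' ∧
      cs.wordProd ω' = cs.wordProd ω * cs.simple c := by
  rcases cs.length_mul_simple (cs.wordProd ω) c with h | h
  · refine ⟨ω.concat c, ?_, ?_, cs.wordProd_concat c ω⟩
    · intro b hb
      simp only [List.concat_eq_append, List.mem_append, List.mem_singleton] at hb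
      rcases hb with hb | rfl
      · exact hω b hb
      · exact hc
    · unfold CoxeterSystem.IsReduced
      rw [cs.wordProd_concat, h, hr.eq]; simp
  · obtain ⟨j, hj, he⟩ := exchange cs ω c (by omega)
    refine ⟨ω.eraseIdx j, fun b hb => hω b (List.mem_of_mem_eraseIdx hb), ?_, he.symm⟩
    unfold CoxeterSystem.IsReduced
    rw [← he, List.length_eraseIdx_of_lt hj]
    have := hr.eq
    omega

/-- Every element of `W_K` has a reduced word in `K`. -/
theorem par_word (cs : CoxeterSystem M W) {K : Set B} {v : W} (hv : v ∈ par cs K) :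
    ∃ ω : List B, (∀ c ∈ ω, c ∈ K) ∧ cs.IsReduced ω ∧ cs.wordProd ω = v := by
  unfold par at hv
  induction hv using Subgroup.closure_induction_right with
  | one => exact ⟨[], by simp, by simp [CoxeterSystem.IsReduced], by simp⟩
  | mul_right x y hy hx ih =>
    obtain ⟨c, hc, rfl⟩ := hx
    obtain ⟨ω, h1, h2, rfl⟩ := ih
    exact par_word_mul cs h1 h2 hc
  | mul_inv_cancel x y hy hx ih =>
    obtain ⟨c, hc, rfl⟩ := hx
    obtain ⟨ω, h1, h2, rfl⟩ := ih
    rw [cs.inv_simple]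
    exact par_word_mul cs h1 h2 hc

/-- Induction over `W_K` along reduced words. -/
theorem par_induction (cs : CoxeterSystem M W) {K : Set B} {p : W → Prop} (h1 : p 1)
    (hs : ∀ v ∈ par cs K, ∀ c ∈ K, cs.length (v * cs.simple c) = cs.length v + 1 →
      p v → p (v * cs.simple c)) {v : W} (hv : v ∈ par cs K) : p v := by
  obtain ⟨ω, hω, hr, rfl⟩ := par_word cs hv
  clear hv
  induction ω using List.reverseRecOn with
  | nil => simpa using h1
  | append_singleton ω c ih =>
    have hω' : ∀ b ∈ ω, b ∈ K := fun b hb => hω b (by simp [hb])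
    have hr' : cs.IsReduced ω := by
      have := hr.take ω.length
      simpa using this
    rw [cs.wordProd_append, cs.wordProd_singleton]
    refine hs _ (wordProd_mem_par cs hω') c (hω c (by simp)) ?_ (ih hω' hr')
    have := hr.eq
    rw [cs.wordProd_append, cs.wordProd_singleton] at this
    rw [this, hr'.eq]; simp

theorem mem_of_simple_mem_par (cs : CoxeterSystem M W) {K : Set B} {c : B}
    (h : cs.simple c ∈ par cs K) : c ∈ K := by
  obtain ⟨ω, h1, h2, h3⟩ := par_word cs h
  have h4 := h2.eq
  rw [h3, cs.length_simple] at h4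
  obtain ⟨b, rfl⟩ := List.length_eq_one_iff.mp h4.symm
  rw [cs.wordProd_singleton] at h3
  rw [← simple_inj cs h3]
  exact h1 b (by simp)

/-- Exchange applied to a factorisation with additive lengths. -/
theorem exchange_mul (cs : CoxeterSystem M W) (a v : W) (c : B)
    (h : cs.length (a * v * cs.simple c) < cs.length (a * v)) :
    (∃ v', cs.length v' < cs.length v ∧ v' = v * cs.simple c) ∨
    (∃ a', cs.length a' < cs.length a ∧ a * v * cs.simple c = a' * v) := by
  obtain ⟨ω₁, hr₁, rfl⟩ := cs.exists_isReduced a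
  obtain ⟨ω₂, hr₂, rfl⟩ := cs.exists_isReduced v
  rw [← cs.wordProd_append] at h
  obtain ⟨j, hj, he⟩ := exchange cs _ c h
  by_cases hjl : j < ω₁.length
  · right
    refine ⟨cs.wordProd (ω₁.eraseIdx j), ?_, ?_⟩
    · have := cs.length_wordProd_le (ω₁.eraseIdx j)
      rw [List.length_eraseIdx_of_lt hjl] at this
      rw [hr₁.eq]; omega
    · rw [List.eraseIdx_append_of_lt_length hjl, cs.wordProd_append, cs.wordProd_append] at he
      exact he
  · left
    push Not at hjl
    rw [List.eraseIdx_append_of_length_le hjl, cs.wordProd_append, cs.wordProd_append,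
      mul_assoc, mul_right_inj] at he
    refine ⟨_, ?_, he.symm⟩
    rw [List.length_append] at hj
    have := cs.length_wordProd_le (ω₂.eraseIdx (j - ω₁.length))
    rw [List.length_eraseIdx_of_lt (by omega)] at this
    rw [hr₂.eq]; omega

/-- If all `c ∈ K` are right descents of `x`, then `ℓ(xv) = ℓ(x) - ℓ(v)` on `W_K`. -/
theorem length_of_desc (cs : CoxeterSystem M W) {K : Set B} {x : W}
    (hx : ∀ c ∈ K, cs.length (x * cs.simple c) < cs.length x) {v : W} (hv : v ∈ par cs K) :
    cs.length (x * v) + cs.length v = cs.length x := by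
  suffices H : ∀ v ∈ par cs K, cs.length (x * v⁻¹) + cs.length v = cs.length x by
    have := H v⁻¹ ((par cs K).inv_mem hv)
    simpa using this
  intro v hv
  refine par_induction cs (p := fun v => cs.length (x * v⁻¹) + cs.length v = cs.length x)
    (by simp) ?_ hv
  intro v hv c hc hl ih
  have h := hx c hc
  have e := exchange_mul cs (x * v⁻¹) v c (by simpa using h)
  rcases e with ⟨v', h1, h2⟩ | ⟨a', h1, h2⟩
  · subst h2; omega
  · have h3 : a' = x * (v * cs.simple c)⁻¹ := by
      rw [inv_mul_cancel_right] at h2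
      rw [mul_inv_rev, cs.inv_simple, ← mul_assoc, h2]; simp
    have h4 := cs.length_mul_le (x * (v * cs.simple c)⁻¹) (v * cs.simple c)
    rw [inv_mul_cancel_right] at h4
    rw [h3] at h1
    omega

theorem length_of_min_coset (cs : CoxeterSystem M W) {K : Set B} {y : W}
    (hy : ∀ v ∈ par cs K, cs.length y ≤ cs.length (y * v)) {v : W} (hv : v ∈ par cs K) :
    cs.length (y * v) = cs.length y + cs.length v := by
  refine par_induction cs (p := fun v => cs.length (y * v) = cs.length y + cs.length v)
    (by simp) ?_ hv
  intro v hv c hc hl ih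
  rcases cs.length_mul_simple (y * v) c with h | h
  · rw [← mul_assoc]; omega
  · exfalso
    rcases exchange_mul cs y v c (by omega) with ⟨v', h1, h2⟩ | ⟨a', h1, h2⟩
    · subst h2; omega
    · have h3 : a' = y * (v * cs.simple c * v⁻¹) := by
        rw [← mul_assoc, ← mul_assoc, h2]; simp
      have := hy _ ((par cs K).mul_mem ((par cs K).mul_mem hv (simple_mem_par cs hc))
        ((par cs K).inv_mem hv))
      rw [← h3] at this
      omega

/-- If no `c ∈ K` is a right descent of `y`, then `ℓ(yv) = ℓ(y) + ℓ(v)` on `W_K`. -/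
theorem length_of_asc (cs : CoxeterSystem M W) {K : Set B} {y : W}
    (hy : ∀ c ∈ K, cs.length y < cs.length (y * cs.simple c)) {v : W} (hv : v ∈ par cs K) :
    cs.length (y * v) = cs.length y + cs.length v := by
  obtain ⟨m, ⟨v0, hv0, rfl⟩, hmin⟩ : ∃ m, (∃ v ∈ par cs K, m = y * v) ∧
      ∀ v ∈ par cs K, cs.length m ≤ cs.length (y * v) := by
    have hne : {n | ∃ v ∈ par cs K, n = cs.length (y * v)}.Nonempty := ⟨_, 1, one_mem _, rfl⟩
    obtain ⟨v, hv, he⟩ := Nat.sInf_mem hne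
    refine ⟨y * v, ⟨v, hv, rfl⟩, fun v' hv' => ?_⟩
    rw [← he]
    exact Nat.sInf_le ⟨v', hv', rfl⟩
  have hm : ∀ v ∈ par cs K, cs.length (y * v0 * v) = cs.length (y * v0) + cs.length v := by
    intro v hv
    refine length_of_min_coset cs (fun v' hv' => ?_) hv
    rw [mul_assoc]
    exact hmin _ ((par cs K).mul_mem hv0 hv')
  by_cases h1 : v0 = 1
  · subst h1
    simpa using hm v hv
  · exfalso
    obtain ⟨ω, hω, hr, he⟩ := par_word cs hv0
    match ω, hω, hr, he with
    | [], _, _, he => exact h1 (by simpa using he.symm)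
    | c :: ω, hω, hr, he =>
      have hc : c ∈ K := hω c (by simp)
      have hy' := hy c hc
      have e1 := hm v0⁻¹ ((par cs K).inv_mem hv0)
      have e2 := hm (v0⁻¹ * cs.simple c)
        ((par cs K).mul_mem ((par cs K).inv_mem hv0) (simple_mem_par cs hc))
      have e3 : v0⁻¹ * cs.simple c = (cs.wordProd ω)⁻¹ := by
        rw [← he, cs.wordProd_cons]; simp
      have e4 := hr.eq
      have e5 := cs.length_wordProd_le ω
      rw [he, List.length_cons] at e4
      have e6 : y * v0 * (v0⁻¹ * cs.simple c) = y * cs.simple c := by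
        rw [← mul_assoc, mul_inv_cancel_right]
      rw [e6, e3, cs.length_inv] at e2
      rw [mul_inv_cancel_right, cs.length_inv] at e1
      omega

end Parabolic

/-! ### Longest elements -/

section Longest

variable {cs : CoxeterSystem M W} {K : Set B} {w : W}

theorem IsLongest.desc (h : IsLongest cs K w) {c : B} (hc : c ∈ K) :
    cs.length (w * cs.simple c) < cs.length w :=
  lt_of_le_of_ne (h.2 _ ((par cs K).mul_mem h.1 (simple_mem_par cs hc)))
    (cs.length_mul_simple_ne w c)

theorem IsLongest.length_mul (h : IsLongest cs K w) {v : W} (hv : v ∈ par cs K) :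
    cs.length (w * v) + cs.length v = cs.length w :=
  length_of_desc cs (fun _ hc => h.desc hc) hv

theorem IsLongest.unique {w' : W} (h : IsLongest cs K w) (h' : IsLongest cs K w') : w * w' = 1 := by
  have h1 := h.length_mul h'.1
  have h2 := h'.2 w h.1
  exact cs.length_eq_zero_iff.mp (by omega)

theorem IsLongest.mul_self (h : IsLongest cs K w) : w * w = 1 := h.unique h

theorem IsLongest.inv (h : IsLongest cs K w) : w⁻¹ = w := inv_eq_of_mul_eq_one_right h.mul_self

theorem IsLongest.eq {w' : W} (h : IsLongest cs K w) (h' : IsLongest cs K w') : w = w' := by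
  rw [← h.inv]; exact inv_eq_of_mul_eq_one_right (h.unique h')

theorem IsLongest.length_mul' (h : IsLongest cs K w) {v : W} (hv : v ∈ par cs K) :
    cs.length (v * w) + cs.length v = cs.length w := by
  have := h.length_mul ((par cs K).inv_mem hv)
  rw [cs.length_inv, ← cs.length_inv, mul_inv_rev, inv_inv, h.inv] at this
  exact this

theorem IsLongest.length_conj (h : IsLongest cs K w) {v : W} (hv : v ∈ par cs K) :
    cs.length (w * v * w) = cs.length v := by
  have h1 := h.length_mul' hv
  have h2 := h.length_mul ((par cs K).mul_mem hv h.1)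
  rw [← mul_assoc] at h2
  omega

theorem IsLongest.conj_conj (h : IsLongest cs K w) (v : W) : w * (w * v * w) * w = v := by
  have := h.mul_self
  simp only [← mul_assoc, this, one_mul]
  rw [mul_assoc, this, mul_one]

theorem IsLongest.conj_simple (h : IsLongest cs K w) {c : B} (hc : c ∈ K) :
    ∃ c' ∈ K, cs.simple c' = w * cs.simple c * w := by
  have hm := simple_mem_par cs hc
  have h1 := h.length_conj hm
  rw [cs.length_simple] at h1
  obtain ⟨c', hc'⟩ := cs.length_eq_one_iff.mp h1
  refine ⟨c', mem_of_simple_mem_par cs ?_, hc'.symm⟩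
  rw [← hc']
  exact (par cs K).mul_mem ((par cs K).mul_mem h.1 hm) h.1

theorem par_mono (cs : CoxeterSystem M W) {A K : Set B} (h : A ⊆ K) : par cs A ≤ par cs K :=
  Subgroup.closure_mono (Set.image_mono h)

theorem IsLongest.conj_mem (h : IsLongest cs K w) {A A' : Set B} (hA : A ⊆ K)
    (hAA : ∀ c ∈ K, ∀ c' ∈ K, cs.simple c' = w * cs.simple c * w → (c ∈ A ↔ c' ∈ A'))
    {v : W} (hv : v ∈ par cs A) : w * v * w ∈ par cs A' := by
  unfold par at hv
  induction hv using Subgroup.closure_induction with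
  | mem x hx =>
    obtain ⟨c, hc, rfl⟩ := hx
    obtain ⟨c', hc', he⟩ := h.conj_simple (hA hc)
    rw [← he]
    exact simple_mem_par cs ((hAA c (hA hc) c' hc' he).mp hc)
  | one => simp [h.mul_self, one_mem]
  | mul x y _ _ hx hy =>
    have : w * (x * y) * w = (w * x * w) * (w * y * w) := by
      have h2 : (w * x * w) * (w * y * w) = w * x * (w * w) * y * w := by group
      rw [h2, h.mul_self]; group
    rw [this]; exact mul_mem hx hy
  | inv x _ hx =>
    have : w * x⁻¹ * w = (w * x * w)⁻¹ := by
      rw [mul_inv_rev, mul_inv_rev, h.inv]; group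
    rw [this]; exact inv_mem hx

theorem IsLongest.conj_longest (h : IsLongest cs K w) {A A' : Set B} (hA : A ⊆ K) (hA' : A' ⊆ K)
    (hAA : ∀ c ∈ K, ∀ c' ∈ K, cs.simple c' = w * cs.simple c * w → (c ∈ A ↔ c' ∈ A'))
    {v : W} (hv : IsLongest cs A v) : IsLongest cs A' (w * v * w) := by
  refine ⟨h.conj_mem hA hAA hv.1, fun z hz => ?_⟩
  have hz' : w * z * w ∈ par cs A := by
    refine h.conj_mem hA' (fun c hc c' hc' he => ?_) hz
    refine (hAA c' hc' c hc ?_).symm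
    rw [he, h.conj_conj]
  have := hv.2 _ hz'
  rwa [h.length_conj (par_mono cs hA' hz), ← h.length_conj (par_mono cs hA hv.1)] at this

theorem IsLongest.mem_iff (h : IsLongest cs K w) {c : B} :
    c ∈ K ↔ cs.length (w * cs.simple c) < cs.length w := by
  refine ⟨fun hc => h.desc hc, fun hl => ?_⟩
  obtain ⟨ω, h1, h2, h3⟩ := par_word cs h.1
  rw [← h3] at hl
  obtain ⟨j, hj, he⟩ := exchange cs ω c hl
  apply mem_of_simple_mem_par cs
  have h4 : cs.wordProd ω * cs.simple c ∈ par cs K := by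
    rw [he]
    exact wordProd_mem_par cs fun b hb => h1 b (List.mem_of_mem_eraseIdx hb)
  have := (par cs K).mul_mem ((par cs K).inv_mem (h3 ▸ h.1 : cs.wordProd ω ∈ par cs K)) h4
  simpa using this

theorem IsLongest.set_eq {K' : Set B} (h : IsLongest cs K w) (h' : IsLongest cs K' w) :
    K = K' := by
  ext c
  rw [h.mem_iff, h'.mem_iff]

end Longest

theorem statement_18 (cs : CoxeterSystem M W) [Finite W] (wS : W)
    (hwS : ∀ w : W, cs.length w ≤ cs.length wS)
    (s t : B) (hst : cs.simple s ≠ wS * cs.simple t * wS)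
    (sbar : B) (hsbar : cs.simple sbar = wS * cs.simple s * wS)
    (wco : B → W) (hwco : ∀ c, IsLongest cs (Set.univ \ {c}) (wco c))
    (wco2 : B → B → W) (hwco2 : ∀ c c', IsLongest cs (Set.univ \ {c, c'}) (wco2 c c'))
    (u : ℕ → B)
    (hurec : ∀ i, cs.simple (u (i + 2)) = wco (u (i + 1)) * cs.simple (u i) * wco (u (i + 1)))
    (x : ℕ → W)
    (hx0 : x 0 = wco2 (u 0) (u 1))
    (hx : ∀ i, x (i + 1) = x i * wco2 (u i) (u (i + 1)) * wco (u (i + 1)))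
    (d : ℕ)
    (hd : ∀ i ≤ d, (cs.length (x (i + 1)) : ℤ) =
      (cs.length (x i) : ℤ) - cs.length (wco2 (u i) (u (i + 1))) + cs.length (wco (u (i + 1))))
    (hdmax : ∀ k : ℕ, (∀ i ≤ k, (cs.length (x (i + 1)) : ℤ) =
        (cs.length (x i) : ℤ) - cs.length (wco2 (u i) (u (i + 1)))
          + cs.length (wco (u (i + 1)))) → k ≤ d)
    (hu0 : cs.simple (u 0) = wS * cs.simple t * wS)
    (hu1 : u 1 = s)
    (ubar : ℕ → B) (hubar : ∀ i, cs.simple (ubar i) = wS * cs.simple (u i) * wS) :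
    -- (i) `E_d` is a reduced atomic expression of width `d+1`
    -- from `K = S∖{s,t̄}` to `S∖{t,s̄}` with final element `w_S`
    (∃ E : RAtomExpr cs (Set.univ \ {s, u 0}) (Set.univ \ {t, sbar}) (d + 1),
      (∀ i, 1 ≤ i → i ≤ d + 1 → E.letter i = u (i - 1)) ∧
      (∀ i ≤ d + 1, E.Lset i = Set.univ \ {u i, u (i + 1)}) ∧
      E.x (d + 1) = wS) ∧
    -- (ii) the data with letters `(ū_{d+1}, ū_d, …, ū_1)` is a reduced atomic
    -- expression of width `d+1` from `K` to `S∖{t,s̄}`, also with final element `w_S`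
    (∃ E : RAtomExpr cs (Set.univ \ {s, u 0}) (Set.univ \ {t, sbar}) (d + 1),
      (∀ i, 1 ≤ i → i ≤ d + 1 → E.letter i = ubar (d + 3 - i)) ∧
      E.x (d + 1) = wS) ∧
    -- both express the core coset `W_K·w_S·W_{S∖{t,s̄}}`
    IsCore cs (Set.univ \ {s, u 0}) wS (Set.univ \ {t, sbar}) := by
  have hinj := simple_inj cs
  have hS : IsLongest cs Set.univ wS := by
    refine ⟨?_, fun w _ => hwS w⟩
    unfold par
    rw [Set.image_univ, cs.subgroup_closure_range_simple]
    trivial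
  have hSS := hS.mul_self
  -- consecutive letters of the rotation sequence are distinct
  have hne : ∀ i, u i ≠ u (i + 1) := by
    intro i
    induction i with
    | zero =>
      intro h
      apply hst
      rw [← hu0, h, ← hu1]
    | succ i ih =>
      obtain ⟨c', hc', he⟩ := (hwco (u (i + 1))).conj_simple (c := u i) (by simpa using ih)
      rw [← hurec] at he
      rw [hinj he] at hc'
      exact fun h => hc'.2 (by simpa using h.symm)
  set wL : ℕ → W := fun i => wco2 (u i) (u (i + 1)) with hwLdef
  set wK : ℕ → W := fun i => wco (u i) with hwKdef
  have hwLl : ∀ i, IsLongest cs (Set.univ \ {u i, u (i + 1)}) (wL i) := fun i => hwco2 _ _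
  have hwKl : ∀ i, IsLongest cs (Set.univ \ {u i}) (wK i) := fun i => hwco _
  have hx' : ∀ i, x (i + 1) = x i * wL i * wK (i + 1) := hx
  have hx0' : x 0 = wL 0 := hx0
  have hsub : ∀ a b : B, (Set.univ \ {a, b} : Set B) ⊆ Set.univ \ {a} := by
    intro a b c hc
    simp only [Set.mem_sdiff, Set.mem_univ, Set.mem_insert_iff, Set.mem_singleton_iff,
      true_and, not_or] at hc ⊢
    exact hc.1
  have hsub' : ∀ a b : B, (Set.univ \ {a, b} : Set B) ⊆ Set.univ \ {b} := by
    intro a b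
    rw [Set.pair_comm]; exact hsub b a
  -- conjugation by `w_{K_{i+1}}` exchanges `w_{L_i}` and `w_{L_{i+1}}`
  have hconj : ∀ i, wK (i + 1) * wL (i + 1) * wK (i + 1) = wL i := by
    intro i
    refine IsLongest.eq ((hwKl (i + 1)).conj_longest (hsub _ _) (hsub' _ _) ?_ (hwLl (i + 1)))
      (hwLl i)
    intro c hc c' hc' he
    have hiff : c = u (i + 2) ↔ c' = u i := by
      constructor
      · rintro rfl
        apply hinj
        rw [he, hurec, (hwKl (i + 1)).conj_conj]
      · rintro rfl
        apply hinj
        rw [hurec, he, (hwKl (i + 1)).conj_conj]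
    simp only [Set.mem_sdiff, Set.mem_univ, Set.mem_insert_iff, Set.mem_singleton_iff,
      true_and, not_or] at hc hc' ⊢
    rw [hiff]
    tauto
  have hlenL : ∀ i, cs.length (wL i) = cs.length (wL 0) := by
    intro i
    induction i with
    | zero => rfl
    | succ i ih =>
      rw [← ih, ← hconj i, (hwKl (i + 1)).length_conj (par_mono cs (hsub _ _) (hwLl (i + 1)).1)]
  have hcomm : ∀ i, wL 0 * (x i * wL i) = x i := by
    intro i
    induction i with
    | zero => rw [hx0', (hwLl 0).mul_self, mul_one]
    | succ i ih =>
      have e2 : wL i * wK (i + 1) = wK (i + 1) * wL (i + 1) := by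
        rw [← hconj i, mul_assoc _ (wK (i + 1)) (wK (i + 1)), (hwKl (i + 1)).mul_self, mul_one]
      have e3 : wL 0 * (x (i + 1) * wL (i + 1)) =
          wL 0 * (x i * wL i) * (wK (i + 1) * wL (i + 1)) := by
        rw [hx']; group
      rw [e3, ih, hx', mul_assoc (x i), e2]
  have hyL : ∀ i, x i * wL i * wL i = x i := fun i => by
    rw [mul_assoc, (hwLl i).mul_self, mul_one]
  -- additivity of lengths
  have hlen : ∀ i ≤ d + 1, cs.length (x i) = cs.length (x i * wL i) + cs.length (wL i) ∧
      (1 ≤ i → ∀ c, c ≠ u i → cs.length (x i * cs.simple c) < cs.length (x i)) := by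
    intro i
    induction i with
    | zero =>
      intro _
      refine ⟨?_, by omega⟩
      rw [hx0', (hwLl 0).mul_self]; simp
    | succ i ih =>
      intro hi
      have h1 := (ih (by omega)).1
      have h2 := hd i (by omega)
      change (cs.length (x (i + 1)) : ℤ) =
        (cs.length (x i) : ℤ) - cs.length (wL i) + cs.length (wK (i + 1)) at h2
      have h3 : ∀ c, c ≠ u (i + 1) →
          cs.length (x (i + 1) * cs.simple c) < cs.length (x (i + 1)) := by
        intro c hc
        have h4 := (hwKl (i + 1)).desc (c := c) (by simpa using hc)
        have h5 := cs.length_mul_le (x i * wL i) (wK (i + 1) * cs.simple c)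
        rw [← mul_assoc, ← hx'] at h5
        omega
      refine ⟨?_, fun _ => h3⟩
      exact (length_of_desc cs (K := Set.univ \ {u (i + 1)}) (fun c hc => h3 c (by simpa using hc))
        (par_mono cs (hsub _ _) (hwLl (i + 1)).1)).symm
  -- the last letter is a descent
  have hlast : cs.length (x (d + 1) * cs.simple (u (d + 1))) < cs.length (x (d + 1)) := by
    obtain ⟨h1, -⟩ := hlen (d + 1) le_rfl
    by_cases hasc : cs.length (x (d + 1) * wL (d + 1)) <
        cs.length (x (d + 1) * wL (d + 1) * cs.simple (u (d + 1)))
    · exfalso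
      have hall : ∀ c ∈ (Set.univ \ {u (d + 2)} : Set B),
          cs.length (x (d + 1) * wL (d + 1)) <
            cs.length (x (d + 1) * wL (d + 1) * cs.simple c) := by
        intro c hc
        by_cases hcu : c = u (d + 1)
        · rw [hcu]; exact hasc
        · have hcL : c ∈ (Set.univ \ {u (d + 1), u (d + 2)} : Set B) := by
            simp only [Set.mem_sdiff, Set.mem_univ, Set.mem_insert_iff, Set.mem_singleton_iff,
              true_and, not_or] at hc ⊢
            exact ⟨hcu, hc⟩
          have h2 := (hwLl (d + 1)).length_mul' (simple_mem_par cs hcL)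
          rw [cs.length_simple] at h2
          have h3 := cs.length_mul_le (x (d + 1) * wL (d + 1) * cs.simple c)
            (cs.simple c * wL (d + 1))
          have h4 : x (d + 1) * wL (d + 1) * cs.simple c * (cs.simple c * wL (d + 1)) =
              x (d + 1) := by
            rw [← mul_assoc, cs.simple_mul_simple_cancel_right, hyL]
          rw [h4] at h3
          rcases cs.length_mul_simple (x (d + 1) * wL (d + 1)) c with h5 | h5 <;> omega
      have h2 := length_of_asc cs hall (hwKl (d + 2)).1
      have h3 := hdmax (d + 1) (by
        intro i hi
        rcases Nat.lt_or_ge i (d + 1) with hi' | hi'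
        · exact hd i (by omega)
        · obtain rfl : i = d + 1 := by omega
          change (cs.length (x (d + 2)) : ℤ) =
            (cs.length (x (d + 1)) : ℤ) - cs.length (wL (d + 1)) + cs.length (wK (d + 2))
          rw [hx' (d + 1), h2, h1]
          push_cast; ring)
      omega
    · have h2 : cs.length (x (d + 1) * wL (d + 1) * cs.simple (u (d + 1))) <
          cs.length (x (d + 1) * wL (d + 1)) := by
        have := cs.length_mul_simple_ne (x (d + 1) * wL (d + 1)) (u (d + 1))
        omega
      have h3 := cs.length_mul_le (wL 0) (x (d + 1) * wL (d + 1) * cs.simple (u (d + 1)))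
      rw [← mul_assoc, hcomm] at h3
      have h4 := hlenL (d + 1)
      omega
  have hfin : x (d + 1) = wS := by
    have hall : ∀ c ∈ (Set.univ : Set B),
        cs.length (x (d + 1) * cs.simple c) < cs.length (x (d + 1)) := by
      intro c _
      by_cases hc : c = u (d + 1)
      · rw [hc]; exact hlast
      · exact (hlen (d + 1) le_rfl).2 (by omega) c hc
    have h1 := length_of_desc cs hall hS.1
    have h2 := hwS (x (d + 1))
    have h3 : x (d + 1) * wS = 1 := cs.length_eq_zero_iff.mp (by omega)
    rw [eq_inv_of_mul_eq_one_left h3, hS.inv]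
  -- conjugation by `w_S`
  have hbar1 : ∀ a a' : B, cs.simple a' = wS * cs.simple a * wS → ∀ c c' : B,
      cs.simple c' = wS * cs.simple c * wS → (c = a ↔ c' = a') := by
    intro a a' ha c c' hc
    constructor
    · rintro rfl; exact hinj (hc.trans ha.symm)
    · rintro rfl
      apply hinj
      rw [← hS.conj_conj (cs.simple c), ← hc, ha, hS.conj_conj]
  have hbar2 : ∀ a b a' b' : B, cs.simple a' = wS * cs.simple a * wS →
      cs.simple b' = wS * cs.simple b * wS → ∀ c ∈ (Set.univ : Set B), ∀ c' ∈ (Set.univ : Set B),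
      cs.simple c' = wS * cs.simple c * wS →
      (c ∈ (Set.univ \ {a, b} : Set B) ↔ c' ∈ (Set.univ \ {a', b'} : Set B)) := by
    intro a b a' b' ha hb c _ c' _ hc
    have h1 := hbar1 a a' ha c c' hc
    have h2 := hbar1 b b' hb c c' hc
    simp only [Set.mem_sdiff, Set.mem_univ, Set.mem_insert_iff, Set.mem_singleton_iff,
      true_and, h1, h2]
  have hbarL : ∀ i, IsLongest cs (Set.univ \ {ubar i, ubar (i + 1)}) (wS * wL i * wS) := fun i =>
    hS.conj_longest (Set.subset_univ _) (Set.subset_univ _)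
      (hbar2 _ _ _ _ (hubar i) (hubar (i + 1))) (hwLl i)
  have hbarK : ∀ i, IsLongest cs (Set.univ \ {ubar i}) (wS * wK i * wS) := fun i => by
    have h := hS.conj_longest (A := Set.univ \ {u i}) (A' := Set.univ \ {ubar i})
      (Set.subset_univ _) (Set.subset_univ _)
      (by simpa using hbar2 _ _ _ _ (hubar i) (hubar i)) (hwKl i)
    exact h
  have ht' : cs.simple t = wS * cs.simple (u 0) * wS := by rw [hu0, hS.conj_conj]
  have hs' : cs.simple sbar = wS * cs.simple (u 1) * wS := by rw [hu1, hsbar]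
  have hpair := hbar2 (u 0) (u 1) t sbar ht' hs'
  have hLfin : (Set.univ \ {u (d + 1), u (d + 2)} : Set B) = Set.univ \ {t, sbar} := by
    have h1 := hS.conj_longest (Set.subset_univ _) (Set.subset_univ _) hpair (hwLl 0)
    have h2 : wS * wL 0 * wS = wL (d + 1) := by
      have h3 := hcomm (d + 1)
      rw [hfin] at h3
      have h4 : wS * wL (d + 1) = (wL 0)⁻¹ * wS := eq_inv_mul_of_mul_eq h3
      rw [(hwLl 0).inv] at h4
      rw [mul_assoc, ← h4, ← mul_assoc, hSS, one_mul]
    rw [h2] at h1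
    exact (hwLl (d + 1)).set_eq h1
  have hadd : ∀ a b : B, a ≠ b → ((Set.univ \ {a, b} : Set B) ∪ {a}) = Set.univ \ {b} := by
    intro a b hab
    ext c
    simp only [Set.mem_sdiff, Set.mem_univ, Set.mem_insert_iff, Set.mem_singleton_iff,
      true_and, not_or, Set.mem_union]
    constructor
    · rintro (h | rfl)
      · exact h.2
      · exact hab
    · intro h
      by_cases hc : c = a
      · exact Or.inr hc
      · exact Or.inl ⟨hc, h⟩
  have hdel : ∀ a b : B, (Set.univ \ {a} : Set B) \ {b} = Set.univ \ {a, b} := by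
    intro a b
    ext c
    simp
  have hfinW : ∀ K : Set B, Finitary cs K := fun K => Set.toFinite _
  have hnebar : ∀ i, ubar i ≠ ubar (i + 1) := by
    intro i h
    have h1 := (hbar1 (u (i + 1)) (ubar (i + 1)) (hubar _) (u i) (ubar i) (hubar _)).mpr h
    exact hne i h1
  refine ⟨⟨{
      Lset := fun i => Set.univ \ {u i, u (i + 1)}
      letter := fun i => u (i - 1)
      tletter := fun i => u (i + 1)
      wL := wL
      wK := wK
      x := x
      hL0 := by rw [← hu1]; exact congrArg _ (Set.pair_comm _ _)
      hLm := hLfin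
      hwL := fun i _ => hwLl i
      hmem := by intro i _ _; simp
      hfinK := fun i _ _ => hfinW _
      hwK := ?_
      ht := ?_
      hLi := ?_
      hx0 := hx0'
      hx := ?_
      hred := ?_ }, fun i _ _ => rfl, fun i _ => rfl, hfin⟩, ⟨{
      Lset := fun i => Set.univ \ {ubar (d + 1 - i), ubar (d + 1 - i + 1)}
      letter := fun i => ubar (d + 3 - i)
      tletter := fun i => ubar (d + 1 - i)
      wL := fun i => wS * wL (d + 1 - i) * wS
      wK := fun i => wS * wK (d + 1 - i + 1) * wS
      x := fun i => x (d + 1 - i) * wL (d + 1 - i) * wS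
      hL0 := ?_
      hLm := ?_
      hwL := fun i _ => hbarL _
      hmem := ?_
      hfinK := fun i _ _ => hfinW _
      hwK := ?_
      ht := ?_
      hLi := ?_
      hx0 := ?_
      hx := ?_
      hred := ?_ }, fun i _ _ => rfl, ?_⟩, ?_⟩
  · intro i h1 _
    obtain ⟨i, rfl⟩ := Nat.exists_eq_add_of_le' h1
    simp only [Nat.add_sub_cancel]
    rw [hadd _ _ (hne i)]
    exact hwKl (i + 1)
  · intro i h1 _
    obtain ⟨i, rfl⟩ := Nat.exists_eq_add_of_le' h1
    exact hurec i
  · intro i h1 _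
    obtain ⟨i, rfl⟩ := Nat.exists_eq_add_of_le' h1
    simp only [Nat.add_sub_cancel]
    rw [hadd _ _ (hne i), hdel]
  · intro i h1 _
    obtain ⟨i, rfl⟩ := Nat.exists_eq_add_of_le' h1
    exact hx' i
  · intro i h1 h2
    obtain ⟨i, rfl⟩ := Nat.exists_eq_add_of_le' h1
    exact hd i (by omega)
  · -- `bar L_{d+1} = K`
    have e : (Set.univ \ {ubar (d + 1), ubar (d + 2)} : Set B) = Set.univ \ {s, u 0} := by
      have h1 := hbarL (d + 1)
      have h2 : wS * wL (d + 1) * wS = wL 0 := by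
        have h3 := hcomm (d + 1)
        rw [hfin] at h3
        have h4 := congrArg (fun z => z * wS) h3
        simp only [hSS] at h4
        rw [← (hwLl 0).inv]
        exact (inv_eq_of_mul_eq_one_right (by rw [← mul_assoc, h4])).symm
      rw [h2] at h1
      rw [h1.set_eq (hwLl 0), hu1, Set.pair_comm]
    simpa using e
  · -- `bar L_0 = J`
    have e0 : ubar 0 = t := hinj ((hubar 0).trans ht'.symm)
    have e1 : ubar 1 = sbar := hinj ((hubar 1).trans hs'.symm)
    simp [e0, e1]
  · intro i h1 h2
    obtain ⟨j, hj⟩ : ∃ j, d + 1 = i + j := Nat.exists_eq_add_of_le h2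
    rw [show d + 3 - i = j + 2 by omega, show d + 1 - (i - 1) + 1 = j + 2 by omega]
    simp
  · intro i h1 h2
    obtain ⟨j, hj⟩ : ∃ j, d + 1 = i + j := Nat.exists_eq_add_of_le h2
    rw [show d + 3 - i = j + 2 by omega, show d + 1 - (i - 1) = j + 1 by omega,
      show d + 1 - i = j by omega, Set.pair_comm, hadd _ _ (hnebar (j + 1)).symm]
    exact hbarK (j + 1)
  · intro i h1 h2
    obtain ⟨j, hj⟩ : ∃ j, d + 1 = i + j := Nat.exists_eq_add_of_le h2
    rw [show d + 3 - i = j + 2 by omega, show d + 1 - i = j by omega, hubar, hubar, hurec]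
    have hKK : wco (u (j + 1)) * wco (u (j + 1)) = 1 := (hwKl (j + 1)).mul_self
    change wS * cs.simple (u j) * wS = wS * wco (u (j + 1)) * wS *
      (wS * (wco (u (j + 1)) * cs.simple (u j) * wco (u (j + 1))) * wS) *
      (wS * wco (u (j + 1)) * wS)
    generalize wco (u (j + 1)) = k at hKK
    calc wS * cs.simple (u j) * wS
        = wS * (k * k) * cs.simple (u j) * (k * k) * wS := by rw [hKK]; group
      _ = wS * k * (wS * wS) * (k * cs.simple (u j) * k) * (wS * wS) * k * wS := by
          rw [hSS]; group
      _ = _ := by group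
  · intro i h1 h2
    obtain ⟨j, hj⟩ : ∃ j, d + 1 = i + j := Nat.exists_eq_add_of_le h2
    rw [show d + 3 - i = j + 2 by omega, show d + 1 - (i - 1) = j + 1 by omega,
      show d + 1 - i = j by omega, Set.pair_comm (ubar (j + 1)) (ubar (j + 1 + 1)),
      hadd _ _ (hnebar (j + 1)).symm, hdel, Set.pair_comm]
  · simp only [Nat.sub_zero]
    rw [hfin]
  · intro i h1 h2
    obtain ⟨j, hj⟩ : ∃ j, d + 1 = i + j := Nat.exists_eq_add_of_le h2
    rw [show d + 1 - (i - 1) = j + 1 by omega, show d + 1 - i = j by omega]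
    have hKK := (hwKl (j + 1)).mul_self
    have hLL := (hwLl (j + 1)).mul_self
    calc x j * wL j * wS = x j * wL j * (wK (j + 1) * wK (j + 1)) * wS := by rw [hKK, mul_one]
      _ = x (j + 1) * (wL (j + 1) * wL (j + 1)) * wK (j + 1) * wS := by rw [hLL, hx']; group
      _ = x (j + 1) * wL (j + 1) * (wS * wS) * wL (j + 1) * (wS * wS) * wK (j + 1) * wS := by
          rw [hSS]; group
      _ = _ := by group
  · intro i h1 h2
    obtain ⟨j, hj⟩ : ∃ j, d + 1 = i + j := Nat.exists_eq_add_of_le h2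
    rw [show d + 1 - (i - 1) = j + 1 by omega, show d + 1 - i = j by omega]
    have hall : ∀ w : W, w ∈ par cs Set.univ := by
      intro w
      unfold par
      rw [Set.image_univ, cs.subgroup_closure_range_simple]
      trivial
    have a1 := hS.length_mul' (hall (x j * wL j))
    have a2 := hS.length_mul' (hall (x (j + 1) * wL (j + 1)))
    rw [hS.length_conj (hall _), hS.length_conj (hall _)]
    have b1 := (hlen j (by omega)).1
    have b2 := (hlen (j + 1) (by omega)).1
    have b3 := hd j (by omega)
    change (cs.length (x (j + 1)) : ℤ) =
        (cs.length (x j) : ℤ) - cs.length (wL j) + cs.length (wK (j + 1)) at b3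
    omega
  · simp only [Nat.sub_self]
    rw [hx0', (hwLl 0).mul_self, one_mul]
  · -- the coset is core
    have hKJ : ∀ a ∈ par cs (Set.univ \ {s, u 0}), wS * a * wS ∈ par cs (Set.univ \ {t, sbar}) := by
      intro a ha
      rw [← hu1, Set.pair_comm] at ha
      exact hS.conj_mem (Set.subset_univ _) hpair ha
    have hJK : ∀ b ∈ par cs (Set.univ \ {t, sbar}), wS * b * wS ∈ par cs (Set.univ \ {s, u 0}) := by
      intro b hb
      rw [← hu1, Set.pair_comm]
      exact hS.conj_mem (Set.subset_univ _)
        (hbar2 t sbar (u 0) (u 1) hu0 (by rw [hs', hS.conj_conj])) hb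
    constructor
    · ext z
      constructor
      · rintro ⟨a, ha, rfl⟩
        exact ⟨a, ha, 1, one_mem _, by simp⟩
      · rintro ⟨a, ha, b, hb, rfl⟩
        refine ⟨a * (wS * b * wS), mul_mem ha (hJK b hb), ?_⟩
        have : a * (wS * b * wS) * wS = a * wS * b * (wS * wS) := by group
        rw [this, hSS, mul_one]
    · ext z
      constructor
      · rintro ⟨a, ha, b, hb, rfl⟩
        refine ⟨(wS * a * wS) * b, mul_mem (hKJ a ha) hb, ?_⟩
        have : wS * (wS * a * wS * b) = (wS * wS) * a * wS * b := by group
        rw [this, hSS, one_mul]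
      · rintro ⟨b, hb, rfl⟩
        exact ⟨1, one_mem _, b, hb, by simp⟩

end CoxeterAtoms
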